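/- Let K be a field and suppose two finite direct sums of members of Kronecker's list L(K) are isomorphic as transformation-pairs over K. Then for every member κ of L(K), the number of summands isomorphic to κ is the same in both direct sums; that is, the multiplicities [π:κ] of a transformation-pair π are well defined, independent of the chosen decomposition into members of L(K). -/

import Mathlib

open Polynomial

namespace Towber

/-- A transformation-pair over `K`: two `K`-linear maps between
finite-dimensional `K`-vector spaces. -/
structure Pair (K : Type) [Field K] where
  E : Type
  V : Type
  [addE : AddCommGroup E]
  [modE : Module K E]
  [finE : FiniteDimensional K E]
  [addV : AddCommGroup V]
  [modV : Module K V]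
  [finV : FiniteDimensional K V]
  mu : E →ₗ[K] V
  nu : E →ₗ[K] V

attribute [instance] Pair.addE Pair.modE Pair.finE Pair.addV Pair.modV Pair.finV

variable (K : Type) [Field K]

/-- Isomorphism of transformation-pairs. -/
def Pair.Iso (τ σ : Pair K) : Prop :=
  ∃ (α : τ.E ≃ₗ[K] σ.E) (β : τ.V ≃ₗ[K] σ.V),
    (∀ x, σ.mu (α x) = β (τ.mu x)) ∧ (∀ x, σ.nu (α x) = β (τ.nu x))

/-- Finite direct sum of transformation-pairs. -/
noncomputable def dSum (ι : Type) [Finite ι] (τ : ι → Pair K) : Pair K :=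
  letI := Fintype.ofFinite ι
  { E := ∀ i, (τ i).E
    V := ∀ i, (τ i).V
    mu := LinearMap.pi fun i => (τ i).mu ∘ₗ LinearMap.proj i
    nu := LinearMap.pi fun i => (τ i).nu ∘ₗ LinearMap.proj i }

/-- Binary direct sum of transformation-pairs. -/
noncomputable def dSum2 (τ σ : Pair K) : Pair K where
  E := τ.E × σ.E
  V := τ.V × σ.V
  mu := τ.mu.prodMap σ.mu
  nu := τ.nu.prodMap σ.nu

/-- A transformation-pair built from a pair of matrices. -/
noncomputable def ofMats {a b : ℕ} (M N : Matrix (Fin b) (Fin a) K) : Pair K where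
  E := Fin a → K
  V := Fin b → K
  mu := Matrix.toLin' M
  nu := Matrix.toLin' N

/-- `^0T_n = [μ_n, I : K^n → K^n]`, where `μ_n` maps `f_i ↦ f_{i+1}`, `f_n ↦ 0`. -/
noncomputable def zT (n : ℕ) : Pair K :=
  ofMats K (Matrix.of fun j i : Fin n => if (i : ℕ) + 1 = (j : ℕ) then 1 else 0) 1

/-- `T^0_n = [I, μ_n : K^n → K^n]`. -/
noncomputable def Tz (n : ℕ) : Pair K :=
  ofMats K 1 (Matrix.of fun j i : Fin n => if (i : ℕ) + 1 = (j : ℕ) then 1 else 0)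

/-- `T_n = [κ_n, λ_n : K^n → K^{n+1}]`, `κ_n : f_i ↦ f_i`, `λ_n : f_i ↦ f_{i+1}`. -/
noncomputable def Tn (n : ℕ) : Pair K :=
  ofMats K (Matrix.of fun (j : Fin (n+1)) (i : Fin n) => if (j : ℕ) = (i : ℕ) then 1 else 0)
    (Matrix.of fun (j : Fin (n+1)) (i : Fin n) => if (j : ℕ) = (i : ℕ) + 1 then 1 else 0)

/-- `^0T^0_n = [κ'_n, λ'_n : K^{n+1} → K^n]`. -/
noncomputable def zTz (n : ℕ) : Pair K :=
  ofMats K (Matrix.of fun (j : Fin n) (i : Fin (n+1)) => if (j : ℕ) = (i : ℕ) then 1 else 0)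
    (Matrix.of fun (j : Fin n) (i : Fin (n+1)) => if (j : ℕ) + 1 = (i : ℕ) then 1 else 0)

/-- `S(F) = [·X, I : K[X]/(F) → K[X]/(F)]` for a nonzero polynomial `F`. -/
noncomputable def SP (F : Polynomial K) (hF : F ≠ 0) : Pair K :=
  letI : FiniteDimensional K (AdjoinRoot F) := (AdjoinRoot.powerBasis hF).finite
  { E := AdjoinRoot F
    V := AdjoinRoot F
    mu := LinearMap.mulLeft K (AdjoinRoot.root F)
    nu := LinearMap.id }

/-- Membership in Kronecker's list `L(K)` (up to isomorphism). -/
def IsKron (σ : Pair K) : Prop :=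
  (∃ n, 1 ≤ n ∧ Pair.Iso K σ (zT K n)) ∨
  (∃ n, 1 ≤ n ∧ Pair.Iso K σ (Tz K n)) ∨
  (∃ n, Pair.Iso K σ (Tn K n)) ∨
  (∃ n, Pair.Iso K σ (zTz K n)) ∨
  (∃ (p : Polynomial K) (n : ℕ), p.Monic ∧ Irreducible p ∧ p ≠ X ∧ 1 ≤ n ∧
    ∃ h : p ^ n ≠ 0, Pair.Iso K σ (SP K (p ^ n) h))

/-- Being of type `S(p^n)` with `p` monic irreducible, `p ≠ X`, `n ≥ 1`. -/
def IsSType (σ : Pair K) : Prop :=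
  ∃ (p : Polynomial K) (n : ℕ), p.Monic ∧ Irreducible p ∧ p ≠ X ∧ 1 ≤ n ∧
    ∃ h : p ^ n ≠ 0, Pair.Iso K σ (SP K (p ^ n) h)

/-- Membership in Weierstrass' (regular) part of Kronecker's list. -/
def IsKronReg (σ : Pair K) : Prop :=
  (∃ n, 1 ≤ n ∧ Pair.Iso K σ (zT K n)) ∨
  (∃ n, 1 ≤ n ∧ Pair.Iso K σ (Tz K n)) ∨
  (∃ (p : Polynomial K) (n : ℕ), p.Monic ∧ Irreducible p ∧ p ≠ X ∧ 1 ≤ n ∧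
    ∃ h : p ^ n ≠ 0, Pair.Iso K σ (SP K (p ^ n) h))

/-- A finite binary relation `(R, S)`. -/
structure BRel where
  S : Type
  R : S → S → Prop
  [fin : Finite S]

attribute [instance] BRel.fin

/-- The generating relation for left contraction:
`y ~ y'` whenever `∃ x, xRy ∧ xRy'`. -/
def BRel.lgen (Γ : BRel) : Γ.S → Γ.S → Prop := fun y y' => ∃ x, Γ.R x y ∧ Γ.R x y'

/-- The generating relation for right contraction:
`x ~ x'` whenever `∃ y, xRy ∧ x'Ry`. -/
def BRel.rgen (Γ : BRel) : Γ.S → Γ.S → Prop := fun x x' => ∃ y, Γ.R x y ∧ Γ.R x' y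

/-- Quotient of a binary relation by (the equivalence relation generated by) `r`:
two classes are related iff some representatives are related. -/
def BRel.quotBy (Γ : BRel) (r : Γ.S → Γ.S → Prop) : BRel where
  S := Quot r
  R := fun α β => ∃ a b, Quot.mk r a = α ∧ Quot.mk r b = β ∧ Γ.R a b

/-- Left contraction `C_l Γ`. -/
def BRel.Cl (Γ : BRel) : BRel := Γ.quotBy Γ.lgen

/-- Right contraction `C_r Γ`. -/
def BRel.Cr (Γ : BRel) : BRel := Γ.quotBy Γ.rgen

/-- Graph-isomorphism of binary relations. -/
def BRel.Iso (Γ Δ : BRel) : Prop :=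
  ∃ φ : Γ.S ≃ Δ.S, ∀ a b, Δ.R (φ a) (φ b) ↔ Γ.R a b

/-- `γ_{m,n}(Γ)`, the number of vertices of `C_l^m C_r^n Γ`. -/
noncomputable def BRel.gamma (Γ : BRel) (m n : ℕ) : ℕ :=
  Nat.card ((BRel.Cl^[m] (BRel.Cr^[n] Γ)).S)

/-- `Γ` has stabilized at `N`: for all `m, n ≥ N` the iterated contraction
`C_l^m C_r^n Γ` is graph-isomorphic to `C_l^N C_r^N Γ`. -/
def BRel.StabAt (Γ : BRel) (N : ℕ) : Prop :=
  ∀ m, N ≤ m → ∀ n, N ≤ n →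
    BRel.Iso (BRel.Cl^[m] (BRel.Cr^[n] Γ)) (BRel.Cl^[N] (BRel.Cr^[N] Γ))

/-- Number of edges of a binary relation. -/
noncomputable def BRel.edges (Γ : BRel) : ℕ :=
  Nat.card {p : Γ.S × Γ.S // Γ.R p.1 p.2}

/-- The `K`-linearization of a finite binary relation. -/
noncomputable def BRel.linz (Γ : BRel) : Pair K :=
  letI := Fintype.ofFinite Γ.S
  letI := Classical.decEq Γ.S
  letI : DecidablePred (fun p : Γ.S × Γ.S => Γ.R p.1 p.2) := Classical.decPred _
  { E := {p : Γ.S × Γ.S // Γ.R p.1 p.2} → K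
    V := Γ.S → K
    mu := Matrix.toLin' (Matrix.of fun (v : Γ.S) (e : {p : Γ.S × Γ.S // Γ.R p.1 p.2}) =>
      if e.1.1 = v then 1 else 0)
    nu := Matrix.toLin' (Matrix.of fun (v : Γ.S) (e : {p : Γ.S × Γ.S // Γ.R p.1 p.2}) =>
      if e.1.2 = v then 1 else 0) }

/-- The disjoint union of the paths `L_{m i}` (on `m i` vertices) and the
cycles `C_{c j}` (on `c j` vertices). -/
def modelGraph (p q : ℕ) (m : Fin p → ℕ) (c : Fin q → ℕ) : BRel where
  S := (Σ i, Fin (m i)) ⊕ (Σ j, Fin (c j))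
  R := fun x y =>
    (∃ (i : Fin p) (a b : Fin (m i)),
        x = Sum.inl ⟨i, a⟩ ∧ y = Sum.inl ⟨i, b⟩ ∧ (b : ℕ) = (a : ℕ) + 1) ∨
    (∃ (j : Fin q) (a b : Fin (c j)),
        x = Sum.inr ⟨j, a⟩ ∧ y = Sum.inr ⟨j, b⟩ ∧ (b : ℕ) = ((a : ℕ) + 1) % (c j))

/-- A finite directed graph, possibly with parallel edges. -/
structure DiGraph where
  E : Type
  V : Type
  [finE : Finite E]
  [finV : Finite V]
  init : E → V
  term : E → V

attribute [instance] DiGraph.finE DiGraph.finV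

/-- The parallelism relation on the edges of a directed graph. -/
def DiGraph.par (G : DiGraph) : G.E → G.E → Prop :=
  fun e e' => G.init e = G.init e' ∧ G.term e = G.term e'

/-- The reduced form of a directed graph: edges are parallelism classes. -/
def DiGraph.red (G : DiGraph) : DiGraph where
  E := Quot G.par
  V := G.V
  init := Quot.lift G.init fun _ _ h => h.1
  term := Quot.lift G.term fun _ _ h => h.2

/-- The `K`-linearization of a finite directed graph. -/
noncomputable def DiGraph.linz (G : DiGraph) : Pair K :=
  letI := Fintype.ofFinite G.E
  letI := Fintype.ofFinite G.V
  letI := Classical.decEq G.V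
  letI := Classical.decEq G.E
  { E := G.E → K
    V := G.V → K
    mu := Matrix.toLin' (Matrix.of fun (v : G.V) (e : G.E) => if G.init e = v then 1 else 0)
    nu := Matrix.toLin' (Matrix.of fun (v : G.V) (e : G.E) => if G.term e = v then 1 else 0) }

section KrullSchmidt

variable {K}

/-- The space of morphisms between two transformation-pairs. -/
def Pair.homSubmodule (τ σ : Pair K) :
    Submodule K ((τ.E →ₗ[K] σ.E) × (τ.V →ₗ[K] σ.V)) where
  carrier := {f | (∀ x, σ.mu (f.1 x) = f.2 (τ.mu x)) ∧ ∀ x, σ.nu (f.1 x) = f.2 (τ.nu x)}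
  zero_mem' := by simp
  add_mem' := by
    rintro f g ⟨hf, hf'⟩ ⟨hg, hg'⟩
    simp [hf, hf', hg, hg']
  smul_mem' := by
    rintro c f ⟨hf, hf'⟩
    simp [hf, hf']

/-- The type of morphisms between two transformation-pairs. -/
abbrev Pair.Hom (τ σ : Pair K) : Type := τ.homSubmodule σ

/-- Composition of morphisms. -/
def Pair.Hom.comp {τ σ ρ : Pair K} (g : σ.Hom ρ) (f : τ.Hom σ) : τ.Hom ρ :=
  ⟨(g.1.1 ∘ₗ f.1.1, g.1.2 ∘ₗ f.1.2), by
    have hf := f.2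
    have hg := g.2
    exact ⟨fun x => by simp [hg.1, hf.1], fun x => by simp [hg.2, hf.2]⟩⟩

/-- The identity morphism. -/
def Pair.Hom.id (τ : Pair K) : τ.Hom τ :=
  ⟨(LinearMap.id, LinearMap.id), by simp [Pair.homSubmodule]⟩

/-- A morphism is bijective if both of its components are. -/
def Pair.Hom.Bijective {τ σ : Pair K} (f : τ.Hom σ) : Prop :=
  Function.Bijective f.1.1 ∧ Function.Bijective f.1.2

/-- A nonzero transformation-pair whose non-invertible endomorphisms are closed under sums. -/
structure Pair.IsLocal (τ : Pair K) : Prop where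
  zero : ¬ (0 : τ.Hom τ).Bijective
  add : ∀ f g : τ.Hom τ, (f + g).Bijective → f.Bijective ∨ g.Bijective

namespace Pair.Hom

variable {τ σ ρ π : Pair K}

theorem bijective_id : (Hom.id τ).Bijective :=
  ⟨Function.bijective_id, Function.bijective_id⟩

theorem Bijective.comp {g : σ.Hom ρ} {f : τ.Hom σ} (hg : g.Bijective) (hf : f.Bijective) :
    (g.comp f).Bijective :=
  ⟨hg.1.comp hf.1, hg.2.comp hf.2⟩

theorem comp_assoc (h : ρ.Hom π) (g : σ.Hom ρ) (f : τ.Hom σ) :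
    (h.comp g).comp f = h.comp (g.comp f) := rfl

theorem id_comp (f : τ.Hom σ) : (Hom.id σ).comp f = f := rfl

theorem comp_add (g : σ.Hom ρ) (f f' : τ.Hom σ) : g.comp (f + f') = g.comp f + g.comp f' := by
  apply Subtype.ext
  simp [Hom.comp, LinearMap.comp_add]

theorem add_comp (g g' : σ.Hom ρ) (f : τ.Hom σ) : (g + g').comp f = g.comp f + g'.comp f := by
  apply Subtype.ext
  simp [Hom.comp, LinearMap.add_comp]

theorem sub_comp (g g' : σ.Hom ρ) (f : τ.Hom σ) : (g - g').comp f = g.comp f - g'.comp f := by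
  apply Subtype.ext
  simp [Hom.comp, LinearMap.sub_comp]

theorem comp_zero (g : σ.Hom ρ) : g.comp (0 : τ.Hom σ) = 0 := by
  apply Subtype.ext
  simp [Hom.comp]

theorem comp_smul (c : K) (g : σ.Hom ρ) (f : τ.Hom σ) : g.comp (c • f) = (c • g).comp f := by
  apply Subtype.ext
  simp [Hom.comp, LinearMap.comp_smul, LinearMap.smul_comp]

theorem finsetSum_comp {ι : Type} (s : Finset ι) (g : ι → σ.Hom ρ) (f : τ.Hom σ) :
    (∑ i ∈ s, g i).comp f = ∑ i ∈ s, (g i).comp f := by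
  classical
  induction s using Finset.induction_on with
  | empty => apply Subtype.ext; simp [Hom.comp]
  | insert a s ha ih => rw [Finset.sum_insert ha, Finset.sum_insert ha, add_comp, ih]

theorem comp_finsetSum {ι : Type} (s : Finset ι) (g : σ.Hom ρ) (f : ι → τ.Hom σ) :
    g.comp (∑ i ∈ s, f i) = ∑ i ∈ s, g.comp (f i) := by
  classical
  induction s using Finset.induction_on with
  | empty => exact comp_zero g
  | insert a s ha ih => rw [Finset.sum_insert ha, Finset.sum_insert ha, comp_add, ih]

theorem Bijective.exists_inverse {f : τ.Hom σ} (hf : f.Bijective) :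
    ∃ g : σ.Hom τ, g.comp f = Hom.id τ ∧ f.comp g = Hom.id σ := by
  let a := LinearEquiv.ofBijective f.1.1 hf.1
  let b := LinearEquiv.ofBijective f.1.2 hf.2
  have ha : ∀ x, f.1.1 x = a x := fun _ => rfl
  have hb : ∀ x, f.1.2 x = b x := fun _ => rfl
  refine ⟨⟨(a.symm, b.symm), fun x => ?_, fun x => ?_⟩, ?_, ?_⟩
  · apply b.injective
    have := f.2.1 (a.symm x)
    rw [ha, hb] at this
    simpa using this.symm
  · apply b.injective
    have := f.2.2 (a.symm x)
    rw [ha, hb] at this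
    simpa using this.symm
  · apply Subtype.ext
    refine Prod.ext (LinearMap.ext fun x => ?_) (LinearMap.ext fun x => ?_)
    · exact a.symm_apply_apply x
    · exact b.symm_apply_apply x
  · apply Subtype.ext
    refine Prod.ext (LinearMap.ext fun x => ?_) (LinearMap.ext fun x => ?_)
    · exact a.apply_symm_apply x
    · exact b.apply_symm_apply x

theorem bijective_of_inverse {f : τ.Hom σ} {g : σ.Hom τ} (hgf : g.comp f = Hom.id τ)
    (hfg : f.comp g = Hom.id σ) : f.Bijective := by
  have h1 := congrArg (fun u => u.1.1) hgf
  have h2 := congrArg (fun u => u.1.2) hgf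
  have h3 := congrArg (fun u => u.1.1) hfg
  have h4 := congrArg (fun u => u.1.2) hfg
  exact ⟨Function.bijective_iff_has_inverse.2 ⟨g.1.1, LinearMap.congr_fun h1,
    LinearMap.congr_fun h3⟩, Function.bijective_iff_has_inverse.2 ⟨g.1.2, LinearMap.congr_fun h2,
    LinearMap.congr_fun h4⟩⟩

end Pair.Hom

theorem Pair.iso_iff_exists_bijective {τ σ : Pair K} :
    Pair.Iso K τ σ ↔ ∃ f : τ.Hom σ, f.Bijective := by
  constructor
  · rintro ⟨α, β, h1, h2⟩
    exact ⟨⟨(α, β), h1, h2⟩, α.bijective, β.bijective⟩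
  · rintro ⟨f, hf⟩
    exact ⟨LinearEquiv.ofBijective f.1.1 hf.1, LinearEquiv.ofBijective f.1.2 hf.2, f.2.1, f.2.2⟩

theorem Pair.Iso.exists_inverse {τ σ : Pair K} (h : Pair.Iso K τ σ) :
    ∃ (f : τ.Hom σ) (g : σ.Hom τ), g.comp f = Hom.id τ ∧ f.comp g = Hom.id σ := by
  obtain ⟨f, hf⟩ := Pair.iso_iff_exists_bijective.1 h
  exact ⟨f, hf.exists_inverse⟩

theorem Pair.IsLocal.of_iso {τ σ : Pair K} (h : Pair.Iso K τ σ) (hσ : σ.IsLocal) :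
    τ.IsLocal := by
  obtain ⟨f, g, hgf, hfg⟩ := h.exists_inverse
  have hf := Hom.bijective_of_inverse hgf hfg
  have hg := Hom.bijective_of_inverse hfg hgf
  have key : ∀ u : τ.Hom τ, ((f.comp u).comp g).Bijective → u.Bijective := by
    intro u hu
    have : u = (g.comp ((f.comp u).comp g)).comp f := by
      rw [Hom.comp_assoc, Hom.comp_assoc, Hom.comp_assoc, hgf, ← Hom.comp_assoc, hgf]
      rfl
    rw [this]
    exact (hg.comp hu).comp hf
  refine ⟨fun h0 => hσ.zero ?_, fun u v huv => ?_⟩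
  · have := (hf.comp h0).comp hg
    rwa [Hom.comp_zero, show (0 : τ.Hom σ).comp g = 0 from Subtype.ext (by simp [Hom.comp])]
      at this
  · have := (hf.comp huv).comp hg
    rw [Hom.comp_add, Hom.add_comp] at this
    exact (hσ.add _ _ this).imp (key u) (key v)

/-- The morphisms from `κ` to `M` that are not split monomorphisms. -/
def Pair.IsLocal.rad {κ : Pair K} (hκ : κ.IsLocal) (M : Pair K) : Submodule K (κ.Hom M) where
  carrier := {f | ∀ g : M.Hom κ, ¬ (g.comp f).Bijective}
  zero_mem' g := by
    rw [Hom.comp_zero]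
    exact hκ.zero
  add_mem' := by
    intro f f' hf hf' g hg
    rw [Hom.comp_add] at hg
    exact (hκ.add _ _ hg).elim (hf g) (hf' g)
  smul_mem' := by
    intro c f hf g
    rw [Hom.comp_smul]
    exact hf _

theorem Pair.IsLocal.rad_eq_top {κ M : Pair K} (hκ : κ.IsLocal) (hM : M.IsLocal)
    (h : ¬ Pair.Iso K M κ) : hκ.rad M = ⊤ := by
  rw [eq_top_iff]
  rintro f - g hgf
  apply h
  rw [Pair.iso_iff_exists_bijective]
  obtain ⟨u, hu, -⟩ := hgf.exists_inverse
  rw [← Hom.comp_assoc] at hu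
  set r := u.comp g with hr
  have hsum : (f.comp r + (Hom.id M - f.comp r)).Bijective := by
    rw [add_sub_cancel]
    exact Hom.bijective_id
  rcases hM.add _ _ hsum with h1 | h1
  · obtain ⟨v, -, hv⟩ := h1.exists_inverse
    have hb : f.Bijective := by
      have hv' : f.comp (r.comp v) = Hom.id M := hv
      have : r.comp v = r := by
        calc r.comp v = (r.comp f).comp (r.comp v) := by rw [hu]; rfl
          _ = r.comp (f.comp (r.comp v)) := rfl
          _ = r := by rw [hv']; rfl
      rw [this] at hv'
      exact Hom.bijective_of_inverse hu hv'
    obtain ⟨w, hw, hw'⟩ := hb.exists_inverse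
    exact ⟨w, Hom.bijective_of_inverse hw' hw⟩
  · exfalso
    obtain ⟨v, hv, -⟩ := h1.exists_inverse
    have h0 : (Hom.id M - f.comp r).comp f = 0 := by
      rw [Hom.sub_comp, Hom.comp_assoc, hu]
      exact sub_self f
    have hf : f = 0 := by
      calc f = (v.comp (Hom.id M - f.comp r)).comp f := by rw [hv]; rfl
        _ = v.comp ((Hom.id M - f.comp r).comp f) := rfl
        _ = 0 := by rw [h0, Hom.comp_zero]
    rw [hf, Hom.comp_zero] at hu
    exact hκ.zero (hu ▸ Hom.bijective_id)

/-- Postcomposition with an isomorphism. -/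
def Pair.Hom.congrRight {κ M N : Pair K} (f : M.Hom N) (g : N.Hom M)
    (hgf : g.comp f = Hom.id M) (hfg : f.comp g = Hom.id N) : κ.Hom M ≃ₗ[K] κ.Hom N where
  toFun u := f.comp u
  invFun u := g.comp u
  map_add' := Hom.comp_add f
  map_smul' c u := by
    apply Subtype.ext
    simp [Hom.comp, LinearMap.comp_smul]
  left_inv u := by
    change (g.comp f).comp u = u
    rw [hgf, id_comp]
  right_inv u := by
    change (f.comp g).comp u = u
    rw [hfg, id_comp]

theorem Pair.IsLocal.finrank_quotient_rad_congr {κ M N : Pair K} (hκ : κ.IsLocal)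
    (h : Pair.Iso K M N) :
    Module.finrank K (κ.Hom M ⧸ hκ.rad M) = Module.finrank K (κ.Hom N ⧸ hκ.rad N) := by
  obtain ⟨f, g, hgf, hfg⟩ := h.exists_inverse
  refine (Submodule.Quotient.equiv _ _ (Hom.congrRight f g hgf hfg) ?_).finrank_eq
  ext u
  rw [Submodule.mem_map]
  constructor
  · rintro ⟨v, hv, rfl⟩ w
    exact hv (w.comp f)
  · intro hu
    refine ⟨g.comp u, fun w => ?_, (Hom.congrRight f g hgf hfg).right_inv u⟩
    exact hu (w.comp g)

theorem Pair.IsLocal.finrank_quotient_rad_pos {κ : Pair K} (hκ : κ.IsLocal) :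
    0 < Module.finrank K (κ.Hom κ ⧸ hκ.rad κ) := by
  have : Nontrivial (κ.Hom κ ⧸ hκ.rad κ) := by
    rw [Submodule.Quotient.nontrivial_iff]
    intro h
    have : Hom.id κ ∈ hκ.rad κ := h ▸ Submodule.mem_top
    exact this (Hom.id κ) Hom.bijective_id
  exact Module.finrank_pos

variable {ι : Type} [Finite ι] (τ : ι → Pair K)

/-- The projection from a direct sum to a summand. -/
noncomputable def Pair.Hom.proj (i : ι) : (dSum K ι τ).Hom (τ i) :=
  ⟨(LinearMap.proj (φ := fun i => (τ i).E) i, LinearMap.proj (φ := fun i => (τ i).V) i),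
    fun _ => rfl, fun _ => rfl⟩

open Classical in
/-- The inclusion of a summand into a direct sum. -/
noncomputable def Pair.Hom.single (i : ι) : (τ i).Hom (dSum K ι τ) :=
  ⟨(LinearMap.single K (fun i => (τ i).E) i, LinearMap.single K (fun i => (τ i).V) i), by
    refine ⟨fun x => funext fun j => ?_, fun x => funext fun j => ?_⟩
    · change (τ j).mu ((Pi.single i x : ∀ i, (τ i).E) j) =
        (Pi.single i ((τ i).mu x) : ∀ i, (τ i).V) j
      exact Pi.apply_single (M := fun i => (τ i).E) (N := fun i => (τ i).V)
        (fun j => (τ j).mu) (fun j => map_zero _) i x j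
    · change (τ j).nu ((Pi.single i x : ∀ i, (τ i).E) j) =
        (Pi.single i ((τ i).nu x) : ∀ i, (τ i).V) j
      exact Pi.apply_single (M := fun i => (τ i).E) (N := fun i => (τ i).V)
        (fun j => (τ j).nu) (fun j => map_zero _) i x j⟩

/-- Morphisms into a direct sum are families of morphisms into the summands. -/
noncomputable def Pair.Hom.piEquiv (κ : Pair K) : κ.Hom (dSum K ι τ) ≃ₗ[K] ∀ i, κ.Hom (τ i) where
  toFun u i := (Hom.proj τ i).comp u
  invFun u := ⟨(LinearMap.pi fun i => (u i).1.1, LinearMap.pi fun i => (u i).1.2),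
    fun x => funext fun i => (u i).2.1 x, fun x => funext fun i => (u i).2.2 x⟩
  map_add' _ _ := funext fun _ => Hom.comp_add _ _ _
  map_smul' _ _ := rfl
  left_inv _ := rfl
  right_inv _ := rfl

theorem Pair.Hom.sum_single_comp_proj [Fintype ι] :
    ∑ i, (Hom.single τ i).comp (Hom.proj τ i) = Hom.id (dSum K ι τ) := by
  classical
  apply Subtype.ext
  refine Prod.ext (LinearMap.ext fun x => ?_) (LinearMap.ext fun x => ?_)
  · rw [Submodule.coe_sum, Prod.fst_sum, LinearMap.sum_apply]
    exact Finset.univ_sum_single (M := fun i => (τ i).E) x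
  · rw [Submodule.coe_sum, Prod.snd_sum, LinearMap.sum_apply]
    exact Finset.univ_sum_single (M := fun i => (τ i).V) x

theorem Pair.IsLocal.sum_bijective {κ : Pair K} (hκ : κ.IsLocal) {ι : Type} (s : Finset ι)
    (f : ι → κ.Hom κ) (h : (∑ i ∈ s, f i).Bijective) : ∃ i ∈ s, (f i).Bijective := by
  classical
  induction s using Finset.induction_on with
  | empty => exact absurd h hκ.zero
  | insert a s ha ih =>
    rw [Finset.sum_insert ha] at h
    rcases hκ.add _ _ h with h | h
    · exact ⟨a, by simp, h⟩
    · obtain ⟨i, hi, h⟩ := ih h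
      exact ⟨i, by simp [hi], h⟩

theorem Pair.IsLocal.finrank_quotient_rad_dSum [Fintype ι] {κ : Pair K} (hκ : κ.IsLocal) :
    Module.finrank K (κ.Hom (dSum K ι τ) ⧸ hκ.rad (dSum K ι τ)) =
      ∑ i, Module.finrank K (κ.Hom (τ i) ⧸ hκ.rad (τ i)) := by
  classical
  have : ∀ i, Module.Free K (κ.Hom (τ i) ⧸ hκ.rad (τ i)) :=
    fun i => Module.Free.of_divisionRing K _
  rw [← Module.finrank_pi_fintype]
  refine LinearEquiv.finrank_eq (LinearEquiv.trans
    (Submodule.Quotient.equiv _ (Submodule.pi Set.univ fun i => hκ.rad (τ i))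
      (Hom.piEquiv τ κ) ?_) (Submodule.quotientPi fun i => hκ.rad (τ i)))
  ext u
  rw [Submodule.mem_map]
  constructor
  · rintro ⟨v, hv, rfl⟩ i - w
    exact hv (w.comp (Hom.proj τ i))
  · intro hu
    refine ⟨(Hom.piEquiv τ κ).symm u, fun w hw => ?_, (Hom.piEquiv τ κ).right_inv u⟩
    set v := (Hom.piEquiv τ κ).symm u with hv
    have hsum : w.comp v = ∑ i, ((w.comp (Hom.single τ i)).comp (Hom.proj τ i)).comp v := by
      simp_rw [← Hom.finsetSum_comp, Hom.comp_assoc w, ← Hom.comp_finsetSum,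
        Hom.sum_single_comp_proj]
      rfl
    rw [hsum] at hw
    obtain ⟨i, -, hi⟩ := hκ.sum_bijective _ _ hw
    exact hu i trivial (w.comp (Hom.single τ i)) hi

theorem Pair.IsLocal.finrank_quotient_rad_eq_card_mul [Fintype ι] {κ : Pair K} (hκ : κ.IsLocal)
    (hτ : ∀ i, (τ i).IsLocal) :
    Module.finrank K (κ.Hom (dSum K ι τ) ⧸ hκ.rad (dSum K ι τ)) =
      Nat.card {i : ι // Pair.Iso K (τ i) κ} * Module.finrank K (κ.Hom κ ⧸ hκ.rad κ) := by
  classical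
  have key : ∀ i, Module.finrank K (κ.Hom (τ i) ⧸ hκ.rad (τ i)) =
      if Pair.Iso K (τ i) κ then Module.finrank K (κ.Hom κ ⧸ hκ.rad κ) else 0 := by
    intro i
    split_ifs with h
    · exact hκ.finrank_quotient_rad_congr h
    · rw [hκ.rad_eq_top (hτ i) h]
      exact Module.finrank_zero_of_subsingleton
  rw [hκ.finrank_quotient_rad_dSum, Finset.sum_congr rfl fun i _ => key i, ← Finset.sum_filter,
    Finset.sum_const, smul_eq_mul, Nat.card_eq_fintype_card, Fintype.card_subtype]

/-- A sufficient criterion for locality: invertibility is detected by an additive invariant. -/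
theorem Pair.IsLocal.of_addMonoidHom {τ : Pair K} {G : Type} [AddGroup G] (c : τ.Hom τ →+ G)
    (hc : ∀ f, f.Bijective ↔ c f ≠ 0) : τ.IsLocal := by
  refine ⟨by simp [hc], fun f g h => ?_⟩
  rw [hc, map_add] at h
  rw [hc, hc]
  by_contra! h'
  exact h (by rw [h'.1, h'.2, add_zero])

theorem det_of_lowerTriangular_toeplitz {m : ℕ} (T : Matrix (Fin m) (Fin m) K) (c : K)
    (h0 : ∀ i j : Fin m, (i : ℕ) = 0 → (j : ℕ) = 0 → T i j = c)
    (h1 : ∀ i j : Fin m, (i : ℕ) = 0 → (j : ℕ) ≠ 0 → T i j = 0)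
    (h2 : ∀ i j i' j' : Fin m, (i' : ℕ) = i + 1 → (j' : ℕ) = j + 1 → T i' j' = T i j) :
    T.det = c ^ m := by
  have key : ∀ (a : ℕ) (i j : Fin m), (i : ℕ) = a → (i : ℕ) ≤ j →
      T i j = if i = j then c else 0 := by
    intro a
    induction a with
    | zero =>
      intro i j hi _
      split_ifs with h
      · exact h0 i j hi (h ▸ hi)
      · exact h1 i j hi fun hj => h (Fin.ext (hi.trans hj.symm))
    | succ a ih =>
      intro i j hi hij
      rw [h2 ⟨a, by omega⟩ ⟨j - 1, by omega⟩ i j hi (by simp; omega),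
        ih _ _ rfl (by simp; omega)]
      simp only [Fin.ext_iff]
      split_ifs <;> first | rfl | omega
  rw [Matrix.det_of_isLowerTriangular]
  · rw [Finset.prod_congr rfl fun i _ => (key _ i i rfl le_rfl).trans (if_pos rfl)]
    simp
  · intro i j hij
    have hij : i < j := hij
    rw [key _ i j rfl hij.le, if_neg hij.ne]

theorem bijective_iff_det_toMatrix'_ne_zero {m : ℕ} (f : (Fin m → K) →ₗ[K] (Fin m → K)) :
    Function.Bijective f ↔ (LinearMap.toMatrix' f).det ≠ 0 := by
  rw [← Module.End.isUnit_iff, LinearMap.isUnit_iff_isUnit_det, isUnit_iff_ne_zero,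
    LinearMap.det_toMatrix']

theorem Pair.IsLocal.ofMats {a b : ℕ} {M N : Matrix (Fin b) (Fin a) K}
    (c : Matrix (Fin a) (Fin a) K × Matrix (Fin b) (Fin b) K →+ K)
    (hc : ∀ A B, M * A = B * M → N * A = B * N → (A.det ≠ 0 ∧ B.det ≠ 0 ↔ c (A, B) ≠ 0)) :
    (ofMats K M N).IsLocal := by
  refine Pair.IsLocal.of_addMonoidHom (G := K)
    { toFun := fun f => c (LinearMap.toMatrix' (n := Fin a) (m := Fin a) f.1.1,
        LinearMap.toMatrix' (n := Fin b) (m := Fin b) f.1.2)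
      map_zero' := (congrArg c (Prod.ext (map_zero _) (map_zero _))).trans (map_zero c)
      map_add' := fun f g =>
        (congrArg c (Prod.ext (map_add _ _ _) (map_add _ _ _))).trans (map_add c _ _) } ?_
  rintro ⟨⟨A, B⟩, h1, h2⟩
  change (Fin a → K) →ₗ[K] (Fin a → K) at A
  change (Fin b → K) →ₗ[K] (Fin b → K) at B
  refine Iff.trans ?_ (hc (LinearMap.toMatrix' A) (LinearMap.toMatrix' B) ?_ ?_)
  · exact and_congr (bijective_iff_det_toMatrix'_ne_zero A)
      (bijective_iff_det_toMatrix'_ne_zero B)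
  · apply Matrix.toLin'.injective
    rw [Matrix.toLin'_mul, Matrix.toLin'_mul, Matrix.toLin'_toMatrix', Matrix.toLin'_toMatrix']
    exact LinearMap.ext h1
  · apply Matrix.toLin'.injective
    rw [Matrix.toLin'_mul, Matrix.toLin'_mul, Matrix.toLin'_toMatrix', Matrix.toLin'_toMatrix']
    exact LinearMap.ext h2

section BooleanMatrix

variable {l m n : Type} [Fintype m] (P : l → m → Prop) [∀ i j, Decidable (P i j)]
  (Q : m → n → Prop) [∀ i j, Decidable (Q i j)]

theorem of_ite_mul_apply (A : Matrix m n K) {i : l} {k : m} (h : ∀ k', P i k' ↔ k' = k) (j : n) :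
    (Matrix.of (fun i k => if P i k then (1 : K) else 0) * A) i j = A k j := by
  classical
  simp [Matrix.mul_apply, h]

theorem of_ite_mul_apply_eq_zero (A : Matrix m n K) {i : l} (h : ∀ k, ¬ P i k) (j : n) :
    (Matrix.of (fun i k => if P i k then (1 : K) else 0) * A) i j = 0 := by
  simp [Matrix.mul_apply, h]

theorem mul_of_ite_apply (A : Matrix l m K) (i : l) {j : n} {k : m} (h : ∀ k', Q k' j ↔ k' = k) :
    (A * Matrix.of (fun k j => if Q k j then (1 : K) else 0)) i j = A i k := by
  classical
  simp [Matrix.mul_apply, h]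

theorem mul_of_ite_apply_eq_zero (A : Matrix l m K) (i : l) {j : n} (h : ∀ k, ¬ Q k j) :
    (A * Matrix.of (fun k j => if Q k j then (1 : K) else 0)) i j = 0 := by
  simp [Matrix.mul_apply, h]

end BooleanMatrix

/-- A matrix commuting with the nilpotent Jordan block is triangular with constant diagonal. -/
theorem det_of_commute_shift {n : ℕ} (A : Matrix (Fin (n + 1)) (Fin (n + 1)) K)
    (h : Matrix.of (fun j i : Fin (n + 1) => if (i : ℕ) + 1 = (j : ℕ) then (1 : K) else 0) * A =
      A * Matrix.of (fun j i : Fin (n + 1) => if (i : ℕ) + 1 = (j : ℕ) then (1 : K) else 0)) :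
    A.det = A 0 0 ^ (n + 1) := by
  apply det_of_lowerTriangular_toeplitz
  · intro i j hi hj
    rw [show i = 0 from Fin.ext hi, show j = 0 from Fin.ext hj]
  · intro i j hi hj
    have := congrFun (congrFun h i) ⟨j - 1, by omega⟩
    rw [of_ite_mul_apply_eq_zero _ _ (by intro k; omega),
      mul_of_ite_apply _ _ _ (k := j) (by intro k; simp [Fin.ext_iff]; omega)] at this
    exact this.symm
  · intro i j i' j' hi hj
    have := congrFun (congrFun h i') j
    rw [of_ite_mul_apply _ _ (k := i) (by intro k; simp [Fin.ext_iff]; omega),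
      mul_of_ite_apply _ _ _ (k := j') (by intro k; simp [Fin.ext_iff]; omega)] at this
    exact this.symm

theorem isLocal_zT {n : ℕ} (hn : 1 ≤ n) : (zT K n).IsLocal := by
  obtain ⟨n, rfl⟩ := Nat.exists_eq_add_of_le' hn
  refine Pair.IsLocal.ofMats
    ((Matrix.entryAddMonoidHom K (0 : Fin (n + 1)) (0 : Fin (n + 1))).comp
      (AddMonoidHom.fst _ _)) fun A B h1 h2 => ?_
  obtain rfl : A = B := by simpa using h2
  simp [det_of_commute_shift A h1]

theorem isLocal_Tz {n : ℕ} (hn : 1 ≤ n) : (Tz K n).IsLocal := by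
  obtain ⟨n, rfl⟩ := Nat.exists_eq_add_of_le' hn
  refine Pair.IsLocal.ofMats
    ((Matrix.entryAddMonoidHom K (0 : Fin (n + 1)) (0 : Fin (n + 1))).comp
      (AddMonoidHom.fst _ _)) fun A B h1 h2 => ?_
  obtain rfl : A = B := by simpa using h1
  simp [det_of_commute_shift A h2]

theorem isLocal_Tn (n : ℕ) : (Tn K n).IsLocal := by
  refine Pair.IsLocal.ofMats
    ((Matrix.entryAddMonoidHom K (0 : Fin (n + 1)) (0 : Fin (n + 1))).comp
      (AddMonoidHom.snd _ _)) fun A B h1 h2 => ?_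
  have e1 : ∀ (i j : Fin n) (i' j' : Fin (n + 1)), (i' : ℕ) = i → (j' : ℕ) = j →
      A i j = B i' j' := by
    intro i j i' j' hi hj
    have := congrFun (congrFun h1 i') j
    rwa [of_ite_mul_apply _ _ (k := i) (by intro k; simp [Fin.ext_iff]; omega),
      mul_of_ite_apply _ _ _ (k := j') (by intro k; simp [Fin.ext_iff]; omega)] at this
  have e2 : ∀ (i j : Fin n) (i' j' : Fin (n + 1)), (i' : ℕ) = i + 1 → (j' : ℕ) = j + 1 →
      A i j = B i' j' := by
    intro i j i' j' hi hj
    have := congrFun (congrFun h2 i') j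
    rwa [of_ite_mul_apply _ _ (k := i) (by intro k; simp [Fin.ext_iff]; omega),
      mul_of_ite_apply _ _ _ (k := j') (by intro k; simp [Fin.ext_iff]; omega)] at this
  have e3 : ∀ i j : Fin (n + 1), (i : ℕ) = 0 → (j : ℕ) ≠ 0 → B i j = 0 := by
    intro i j hi hj
    have := congrFun (congrFun h2 i) ⟨j - 1, by omega⟩
    rw [of_ite_mul_apply_eq_zero _ _ (by intro k; omega),
      mul_of_ite_apply _ _ _ (k := j) (by intro k; simp [Fin.ext_iff]; omega)] at this
    exact this.symm
  have hA : A.det = B 0 0 ^ n := by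
    apply det_of_lowerTriangular_toeplitz
    · exact fun i j hi hj => e1 i j 0 0 hi.symm hj.symm
    · exact fun i j hi hj => (e1 i j i.castSucc j.castSucc rfl rfl).trans (e3 _ _ hi hj)
    · exact fun i j i' j' hi hj => (e1 i' j' i'.castSucc j'.castSucc rfl rfl).trans
        (e2 i j _ _ hi hj).symm
  have hB : B.det = B 0 0 ^ (n + 1) := by
    apply det_of_lowerTriangular_toeplitz
    · intro i j hi hj
      rw [show i = 0 from Fin.ext hi, show j = 0 from Fin.ext hj]
    · exact e3
    · exact fun i j i' j' hi hj => (e2 ⟨i, by omega⟩ ⟨j, by omega⟩ i' j' hi hj).symm.trans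
        (e1 _ _ i j rfl rfl)
  simp +contextual [hA, hB]

theorem isLocal_zTz (n : ℕ) : (zTz K n).IsLocal := by
  refine Pair.IsLocal.ofMats
    ((Matrix.entryAddMonoidHom K (0 : Fin (n + 1)) (0 : Fin (n + 1))).comp
      (AddMonoidHom.fst _ _)) fun A B h1 h2 => ?_
  have e1 : ∀ (i j : Fin n) (i' j' : Fin (n + 1)), (i' : ℕ) = i → (j' : ℕ) = j →
      A i' j' = B i j := by
    intro i j i' j' hi hj
    have := congrFun (congrFun h1 i) j'
    rwa [of_ite_mul_apply _ _ (k := i') (by intro k; simp [Fin.ext_iff]; omega),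
      mul_of_ite_apply _ _ _ (k := j) (by intro k; simp [Fin.ext_iff]; omega)] at this
  have e2 : ∀ (i j : Fin n) (i' j' : Fin (n + 1)), (i' : ℕ) = i + 1 → (j' : ℕ) = j + 1 →
      A i' j' = B i j := by
    intro i j i' j' hi hj
    have := congrFun (congrFun h2 i) j'
    rwa [of_ite_mul_apply _ _ (k := i') (by intro k; simp [Fin.ext_iff]; omega),
      mul_of_ite_apply _ _ _ (k := j) (by intro k; simp [Fin.ext_iff]; omega)] at this
  have e3 : ∀ i j : Fin (n + 1), (i : ℕ) ≠ 0 → (j : ℕ) = 0 → A i j = 0 := by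
    intro i j hi hj
    have := congrFun (congrFun h2 ⟨i - 1, by omega⟩) j
    rwa [of_ite_mul_apply _ _ (k := i) (by intro k; simp [Fin.ext_iff]; omega),
      mul_of_ite_apply_eq_zero _ _ _ (by intro k; omega)] at this
  have hA : A.det = A 0 0 ^ (n + 1) := by
    rw [← Matrix.det_transpose]
    apply det_of_lowerTriangular_toeplitz
    · intro i j hi hj
      rw [show i = 0 from Fin.ext hi, show j = 0 from Fin.ext hj, Matrix.transpose_apply]
    · exact fun i j hi hj => e3 j i hj hi
    · exact fun i j i' j' hi hj => (e2 ⟨j, by omega⟩ ⟨i, by omega⟩ j' i' hj hi).trans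
        (e1 _ _ j i rfl rfl).symm
  have hB : B.det = A 0 0 ^ n := by
    rw [← Matrix.det_transpose]
    apply det_of_lowerTriangular_toeplitz
    · exact fun i j hi hj => (e1 j i 0 0 hj.symm hi.symm).symm
    · exact fun i j hi hj => (e1 j i j.castSucc i.castSucc rfl rfl).symm.trans (e3 _ _ hj hi)
    · exact fun i j i' j' hi hj => (e1 j' i' j'.castSucc i'.castSucc rfl rfl).symm.trans
        (e2 j i _ _ hj hi)
  simp +contextual [hA, hB]

theorem isUnit_mk_pow_iff {p : K[X]} (hp : Irreducible p) {n : ℕ} (hn : 1 ≤ n) (q : K[X]) :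
    IsUnit (AdjoinRoot.mk (p ^ n) q) ↔ ¬ p ∣ q := by
  constructor
  · intro h hpq
    obtain ⟨r, hr⟩ := h.exists_right_inv
    obtain ⟨r, rfl⟩ := AdjoinRoot.mk_surjective r
    rw [← map_mul, ← map_one (AdjoinRoot.mk (p ^ n)), AdjoinRoot.mk_eq_mk] at hr
    have h1 : p ∣ q * r - 1 := (dvd_pow_self p (by omega)).trans hr
    exact hp.not_isUnit (isUnit_of_dvd_one ((dvd_sub_right (hpq.mul_right r)).1 h1))
  · intro h
    obtain ⟨a, b, hab⟩ := (((hp.coprime_iff_not_dvd).2 h).pow_left (m := n))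
    have := congrArg (AdjoinRoot.mk (p ^ n)) hab
    rw [map_add, map_mul, map_mul, AdjoinRoot.mk_self, mul_zero, zero_add, map_one] at this
    exact IsUnit.of_mul_eq_one_right _ this

theorem isLocal_SP {p : K[X]} (hp : Irreducible p) {n : ℕ} (hn : 1 ≤ n) (h : p ^ n ≠ 0) :
    (SP K (p ^ n) h).IsLocal := by
  have key : ∀ f : (SP K (p ^ n) h).Hom (SP K (p ^ n) h), ∃ q : K[X],
      f.1.1 (1 : AdjoinRoot (p ^ n)) = AdjoinRoot.mk (p ^ n) q ∧ (f.Bijective ↔ ¬ p ∣ q) := by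
    rintro ⟨⟨α, β⟩, h1, h2⟩
    change AdjoinRoot (p ^ n) →ₗ[K] AdjoinRoot (p ^ n) at α
    change AdjoinRoot (p ^ n) →ₗ[K] AdjoinRoot (p ^ n) at β
    obtain rfl : α = β := LinearMap.ext h2
    have h1 : ∀ x, AdjoinRoot.root (p ^ n) * α x = α (AdjoinRoot.root (p ^ n) * x) := h1
    have hα : ∀ x, α x = α 1 * x := by
      intro x
      obtain ⟨r, rfl⟩ := AdjoinRoot.mk_surjective x
      induction r using Polynomial.induction_on' with
      | add r s hr hs => rw [map_add, map_add, hr, hs, mul_add]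
      | monomial k a =>
        induction k with
        | zero =>
          rw [monomial_zero_left, AdjoinRoot.mk_C, ← AdjoinRoot.algebraMap_eq,
            Algebra.algebraMap_eq_smul_one, map_smul, mul_smul_comm, mul_one]
        | succ k ih =>
          rw [← X_mul_monomial, map_mul, AdjoinRoot.mk_X, ← h1, ih]
          ring
    obtain ⟨q, hq⟩ := AdjoinRoot.mk_surjective (α 1)
    refine ⟨q, hq.symm, ?_⟩
    rw [← isUnit_mk_pow_iff hp hn, hq]
    have : (Function.Bijective α ∧ Function.Bijective α ↔ IsUnit (α 1)) := by
      rw [and_self]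
      have : (α : AdjoinRoot (p ^ n) → AdjoinRoot (p ^ n)) = (α 1 * ·) := funext hα
      rw [IsUnit.isUnit_iff_mulLeft_bijective, ← this]
    exact this
  refine ⟨?_, ?_⟩
  · obtain ⟨q, hq, hb⟩ := key 0
    rw [hb, not_not]
    have : AdjoinRoot.mk (p ^ n) q = 0 := hq.symm
    exact (dvd_pow_self p (by omega)).trans (AdjoinRoot.mk_eq_zero.1 this)
  · intro f g
    obtain ⟨q, hq, hb⟩ := key f
    obtain ⟨q', hq', hb'⟩ := key g
    obtain ⟨r, hr, hbr⟩ := key (f + g)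
    rw [hb, hb', hbr, ← isUnit_mk_pow_iff hp hn, ← hr]
    have : (f + g).1.1 (1 : AdjoinRoot (p ^ n)) = AdjoinRoot.mk (p ^ n) (q + q') := by
      rw [map_add, ← hq, ← hq']
      rfl
    rw [this]
    erw [isUnit_mk_pow_iff hp hn]
    contrapose!
    exact fun h => dvd_add h.1 h.2

theorem IsKron.isLocal {σ : Pair K} (h : IsKron K σ) : σ.IsLocal := by
  rcases h with ⟨n, hn, h⟩ | ⟨n, hn, h⟩ | ⟨n, h⟩ | ⟨n, h⟩ | ⟨p, n, -, hp, -, hn, h0, h⟩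
  · exact .of_iso h (isLocal_zT hn)
  · exact .of_iso h (isLocal_Tz hn)
  · exact .of_iso h (isLocal_Tn n)
  · exact .of_iso h (isLocal_zTz n)
  · exact .of_iso h (isLocal_SP hp hn h0)

end KrullSchmidt

/-- The multiplicities in a decomposition into members of Kronecker's
list are well defined: two isomorphic direct sums contain each member the same number of
times. -/
theorem stmt17 (K : Type) [Field K] (k k' : ℕ) (σ : Fin k → Pair K) (σ' : Fin k' → Pair K)
    (hσ : ∀ i, IsKron K (σ i)) (hσ' : ∀ i, IsKron K (σ' i))
    (h : Pair.Iso K (dSum K (Fin k) σ) (dSum K (Fin k') σ')) :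
    ∀ κ : Pair K, IsKron K κ →
      Nat.card {i : Fin k // Pair.Iso K (σ i) κ} =
        Nat.card {i : Fin k' // Pair.Iso K (σ' i) κ} := by
  intro κ hκ
  have hl := hκ.isLocal
  have h1 := hl.finrank_quotient_rad_eq_card_mul σ fun i => (hσ i).isLocal
  have h2 := hl.finrank_quotient_rad_eq_card_mul σ' fun i => (hσ' i).isLocal
  rw [hl.finrank_quotient_rad_congr h, h2] at h1
  exact (Nat.eq_of_mul_eq_mul_right hl.finrank_quotient_rad_pos h1).symm

end Towber
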